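/- Let (X, Σ, μ) be a measure space and let α > 1 be a real number. Consider the Banach space L^{α+1}(μ) of complex-valued functions and the functional F̂ : L^{α+1}(μ) → ℝ defined by F̂(v) = (1/(α+1)) ∫_X |v(x)|^{α+1} dμ(x). Then for every u ∈ L^{α+1}(μ) there exists a continuous ℝ-linear functional L on L^{α+1}(μ) such that L(h) = Re ∫_X (|u(x)|^{α−1} u(x)) · conj(h(x)) dμ(x) for all h ∈ L^{α+1}(μ), and F̂ is Fréchet differentiable at u (over ℝ) with derivative L. (That is, F̂ is a real antiderivative of F, so F is defocusing.) -/

import Mathlib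

open MeasureTheory

/-- Bernoulli's inequality in homogeneous form. -/
theorem rpow_sub_one_mul_sub_le {r s t : ℝ} (hr : 1 < r) (hs : 0 ≤ s) (ht : 0 ≤ t) :
    s ^ (r - 1) * (t - s) ≤ (t ^ r - s ^ r) / r := by
  have hr0 : 0 < r := by linarith
  have hr1 : 0 < r - 1 := by linarith
  have hpq : (r / (r - 1)).HolderConjugate r := (Real.HolderConjugate.conjExponent hr).symm
  have hy := Real.young_inequality_of_nonneg (Real.rpow_nonneg hs (r - 1)) ht hpq
  rw [← Real.rpow_mul hs, mul_div_cancel₀ _ hr1.ne'] at hy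
  have hm : s ^ (r - 1) * s = s ^ r := by
    rw [← Real.rpow_add_one' hs (by linarith), sub_add_cancel]
  have he : s ^ r / (r / (r - 1)) = s ^ r - s ^ r / r := by
    field_simp
  rw [mul_sub, hm, sub_div]
  linarith

/-- The difference of `z ↦ ‖z‖ ^ a • z` at two points, bounded by the larger norm. -/
theorem norm_rpow_smul_sub_le_of_norm_le {a : ℝ} (ha : 0 < a) {z w : ℂ} (h : ‖w‖ ≤ ‖z‖) :
    ‖(‖z‖ ^ a : ℝ) • z - (‖w‖ ^ a : ℝ) • w‖ ≤ (a + 2) * ‖z‖ ^ a * ‖z - w‖ := by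
  have hz := norm_nonneg z
  have hw := norm_nonneg w
  have hza := Real.rpow_nonneg hz a
  have hd : (‖z‖ ^ a : ℝ) • z - (‖w‖ ^ a : ℝ) • w
      = (‖z‖ ^ a : ℝ) • (z - w) + (‖z‖ ^ a - ‖w‖ ^ a : ℝ) • w := by
    rw [smul_sub, sub_smul]; abel
  have hmono : ‖w‖ ^ a ≤ ‖z‖ ^ a := Real.rpow_le_rpow hw h ha.le
  have hb := rpow_sub_one_mul_sub_le (r := a + 1) (by linarith) hz hw
  rw [add_sub_cancel_right, le_div_iff₀ (by linarith), Real.rpow_add_one' hz (by linarith),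
    Real.rpow_add_one' hw (by linarith)] at hb
  have htri : ‖z‖ - ‖w‖ ≤ ‖z - w‖ := norm_sub_norm_le z w
  have h1 : (‖z‖ ^ a - ‖w‖ ^ a) * ‖w‖ ≤ (a + 1) * ‖z‖ ^ a * (‖z‖ - ‖w‖) := by
    nlinarith [mul_nonneg hza (sub_nonneg.2 h)]
  have h2 : (a + 1) * ‖z‖ ^ a * (‖z‖ - ‖w‖) ≤ (a + 1) * ‖z‖ ^ a * ‖z - w‖ := by gcongr
  rw [hd]
  refine (norm_add_le _ _).trans ?_
  rw [norm_smul, norm_smul, Real.norm_of_nonneg hza, Real.norm_of_nonneg (sub_nonneg.2 hmono)]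
  linarith

theorem norm_rpow_smul_sub_le {a : ℝ} (ha : 0 < a) (z w : ℂ) :
    ‖(‖z‖ ^ a : ℝ) • z - (‖w‖ ^ a : ℝ) • w‖ ≤ (a + 2) * (‖z‖ ^ a + ‖w‖ ^ a) * ‖z - w‖ := by
  have hza := Real.rpow_nonneg (norm_nonneg z) a
  have hwa := Real.rpow_nonneg (norm_nonneg w) a
  rcases le_total ‖w‖ ‖z‖ with h | h
  · refine (norm_rpow_smul_sub_le_of_norm_le ha h).trans ?_
    gcongr
    linarith
  · rw [norm_sub_rev, norm_sub_rev z]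
    refine (norm_rpow_smul_sub_le_of_norm_le ha h).trans ?_
    gcongr
    linarith

/-- The gradient inequality for the convex function `z ↦ ‖z‖ ^ (α + 1) / (α + 1)`. -/
theorem re_rpow_smul_mul_conj_sub_le {α : ℝ} (hα : 1 < α) (z w : ℂ) :
    (((‖z‖ ^ (α - 1) : ℝ) • z) * (starRingEnd ℂ) (w - z)).re
      ≤ (‖w‖ ^ (α + 1) - ‖z‖ ^ (α + 1)) / (α + 1) := by
  have hz := norm_nonneg z
  refine le_trans ?_ (rpow_sub_one_mul_sub_le (r := α + 1) (by linarith) hz (norm_nonneg w))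
  have hre : (z * (starRingEnd ℂ) w).re ≤ ‖z‖ * ‖w‖ := by
    simpa using Complex.re_le_norm (z * (starRingEnd ℂ) w)
  have hself : (z * (starRingEnd ℂ) z).re = ‖z‖ * ‖z‖ := by
    rw [Complex.mul_conj, Complex.normSq_eq_norm_sq, Complex.ofReal_re, sq]
  have hm : ‖z‖ ^ (α + 1 - 1) = ‖z‖ ^ (α - 1) * ‖z‖ := by
    rw [← Real.rpow_add_one' hz (by linarith)]; ring_nf
  rw [smul_mul_assoc, Complex.smul_re, map_sub, mul_sub, Complex.sub_re, hself, hm, smul_eq_mul,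
    mul_assoc]
  gcongr
  linarith

/-- The first-order Taylor remainder of `z ↦ ‖z‖ ^ (α + 1) / (α + 1)` is quadratic. -/
theorem abs_norm_rpow_taylor_remainder_le {α : ℝ} (hα : 1 < α) (z w : ℂ) :
    |(‖w‖ ^ (α + 1) - ‖z‖ ^ (α + 1)) / (α + 1)
        - (((‖z‖ ^ (α - 1) : ℝ) • z) * (starRingEnd ℂ) (w - z)).re|
      ≤ (α + 1) * (‖z‖ ^ (α - 1) * ‖w - z‖ ^ (2 : ℝ) + ‖w‖ ^ (α - 1) * ‖w - z‖ ^ (2 : ℝ)) := by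
  have h1 := re_rpow_smul_mul_conj_sub_le hα z w
  have h2 := re_rpow_smul_mul_conj_sub_le hα w z
  have hL := norm_rpow_smul_sub_le (a := α - 1) (by linarith) w z
  have h3 : (((‖w‖ ^ (α - 1) : ℝ) • w - (‖z‖ ^ (α - 1) : ℝ) • z) * (starRingEnd ℂ) (w - z)).re
      ≤ (α - 1 + 2) * (‖w‖ ^ (α - 1) + ‖z‖ ^ (α - 1)) * ‖w - z‖ * ‖w - z‖ := by
    refine (Complex.re_le_norm _).trans ?_
    rw [norm_mul, RCLike.norm_conj]
    gcongr
  rw [← neg_sub w z, map_neg, mul_neg, Complex.neg_re, ← neg_sub (‖w‖ ^ (α + 1)), neg_div] at h2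
  rw [sub_mul, Complex.sub_re] at h3
  rw [abs_of_nonneg (by linarith), Real.rpow_two]
  linarith

theorem MeasureTheory.Lp.norm_rpow_eq_integral {X : Type*} [MeasurableSpace X] {μ : Measure X}
    {p : ℝ} (hp : 0 < p) (f : Lp ℂ (ENNReal.ofReal p) μ) :
    ‖f‖ = (∫ x, ‖f x‖ ^ p ∂μ) ^ p⁻¹ := by
  rw [Lp.norm_def, (Lp.memLp f).eLpNorm_eq_integral_rpow_norm (by simpa using hp)
    ENNReal.ofReal_ne_top, ENNReal.toReal_ofReal hp.le, ENNReal.toReal_ofReal]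
  exact Real.rpow_nonneg (integral_nonneg fun x => Real.rpow_nonneg (norm_nonneg _) _) _

/-- Hölder's inequality for powers of two elements of the same `L^p` space. -/
theorem MeasureTheory.Lp.integral_norm_rpow_mul_norm_rpow_le {X : Type*} [MeasurableSpace X]
    {μ : Measure X} {a b p : ℝ} (ha : 0 < a) (hb : 0 < b) (hab : a + b = p)
    (f g : Lp ℂ (ENNReal.ofReal p) μ) :
    Integrable (fun x => ‖f x‖ ^ a * ‖g x‖ ^ b) μ ∧
      ∫ x, ‖f x‖ ^ a * ‖g x‖ ^ b ∂μ ≤ ‖f‖ ^ a * ‖g‖ ^ b := by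
  have hp : 0 < p := by linarith
  have hpq : (p / a).HolderConjugate (p / b) := by
    rw [Real.holderConjugate_iff]
    refine ⟨by rw [lt_div_iff₀ ha]; linarith, ?_⟩
    rw [inv_div, inv_div, ← add_div, hab, div_self hp.ne']
  have key : ∀ {c : ℝ}, 0 < c → ∀ k : Lp ℂ (ENNReal.ofReal p) μ,
      MemLp (fun x => ‖k x‖ ^ c) (ENNReal.ofReal (p / c)) μ := by
    intro c hc k
    have := (Lp.memLp k).norm_rpow_div (ENNReal.ofReal c)
    rwa [ENNReal.toReal_ofReal hc.le, ← ENNReal.ofReal_div_of_pos hc] at this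
  have hnorm : ∀ {c : ℝ}, 0 < c → ∀ k : Lp ℂ (ENNReal.ofReal p) μ,
      (∫ x, (‖k x‖ ^ c) ^ (p / c) ∂μ) ^ (1 / (p / c)) = ‖k‖ ^ c := by
    intro c hc k
    have hI : 0 ≤ ∫ x, ‖k x‖ ^ p ∂μ :=
      integral_nonneg fun x => Real.rpow_nonneg (norm_nonneg _) _
    rw [Lp.norm_rpow_eq_integral hp, ← Real.rpow_mul hI]
    simp_rw [← Real.rpow_mul (norm_nonneg _), mul_div_cancel₀ _ hc.ne']
    rw [one_div_div, div_eq_inv_mul]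
  constructor
  · have : ENNReal.HolderConjugate (ENNReal.ofReal (p / a)) (ENNReal.ofReal (p / b)) :=
      hpq.ennrealOfReal
    exact (key ha f).integrable_mul (key hb g)
  · have := integral_mul_le_Lp_mul_Lq_of_nonneg hpq
      (Filter.Eventually.of_forall fun x => Real.rpow_nonneg (norm_nonneg (f x)) a)
      (Filter.Eventually.of_forall fun x => Real.rpow_nonneg (norm_nonneg (g x)) b)
      (key ha f) (key hb g)
    rwa [hnorm ha, hnorm hb] at this

theorem norm_rpow_smul_mul_conj {α : ℝ} (hα : 1 < α) (z w : ℂ) :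
    ‖((‖z‖ ^ (α - 1) : ℝ) • z) * (starRingEnd ℂ) w‖ = ‖z‖ ^ α * ‖w‖ ^ (1 : ℝ) := by
  rw [norm_mul, RCLike.norm_conj, norm_smul,
    Real.norm_of_nonneg (Real.rpow_nonneg (norm_nonneg z) _),
    ← Real.rpow_add_one' (norm_nonneg z) (by linarith), sub_add_cancel, Real.rpow_one]

theorem MeasureTheory.Lp.integrable_rpow_smul_mul_conj {X : Type*} [MeasurableSpace X]
    {μ : Measure X} {α : ℝ} (hα : 1 < α) (u h : Lp ℂ (ENNReal.ofReal (α + 1)) μ) :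
    Integrable (fun x => ((‖u x‖ ^ (α - 1) : ℝ) • u x) * (starRingEnd ℂ) (h x)) μ := by
  refine (Lp.integral_norm_rpow_mul_norm_rpow_le (by linarith) one_pos rfl u h).1.mono' ?_
    (Filter.Eventually.of_forall fun x => (norm_rpow_smul_mul_conj hα (u x) (h x)).le)
  have hu := (Lp.aestronglyMeasurable u).aemeasurable
  have hh := (Lp.aestronglyMeasurable h).aemeasurable
  exact (((hu.norm.pow_const (α - 1)).smul hu).mul
    (Complex.continuous_conj.measurable.comp_aemeasurable hh)).aestronglyMeasurable

/-- the functional `F̂(v) = (α+1)⁻¹ ∫ |v|^{α+1} dμ` on the real Banach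
space `L^{α+1}(μ;ℂ)` is Fréchet differentiable (over ℝ) at every `u`, with derivative
the continuous ℝ-linear functional `h ↦ Re ∫ (|u|^{α−1} u) conj(h) dμ`; i.e. `F̂` is a
real antiderivative of the defocusing nonlinearity `F`. -/
theorem antiderivative_of_nonlinearity
    {X : Type*} [MeasurableSpace X] (μ : Measure X)
    (α : ℝ) (hα : 1 < α) [Fact (1 ≤ ENNReal.ofReal (α + 1))]
    (u : Lp ℂ (ENNReal.ofReal (α + 1)) μ) :
    ∃ L : Lp ℂ (ENNReal.ofReal (α + 1)) μ →L[ℝ] ℝ,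
      (∀ h : Lp ℂ (ENNReal.ofReal (α + 1)) μ,
        L h = (∫ x, ((‖u x‖ ^ (α - 1) : ℝ) • u x) * (starRingEnd ℂ) (h x) ∂μ).re) ∧
      HasFDerivAt
        (fun v : Lp ℂ (ENNReal.ofReal (α + 1)) μ =>
          (1 / (α + 1)) * ∫ x, ‖v x‖ ^ (α + 1) ∂μ)
        L u := by
  have hp : 0 < α + 1 := by linarith
  let ℓ : Lp ℂ (ENNReal.ofReal (α + 1)) μ →ₗ[ℝ] ℝ :=
    { toFun := fun h => (∫ x, ((‖u x‖ ^ (α - 1) : ℝ) • u x) * (starRingEnd ℂ) (h x) ∂μ).re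
      map_add' := fun h k => by
        rw [← Complex.add_re, ← integral_add (Lp.integrable_rpow_smul_mul_conj hα u h)
          (Lp.integrable_rpow_smul_mul_conj hα u k)]
        congr 1
        refine integral_congr_ae ?_
        filter_upwards [Lp.coeFn_add h k] with x hx
        rw [hx, Pi.add_apply, map_add, mul_add]
      map_smul' := fun c h => by
        rw [RingHom.id_apply, ← Complex.smul_re, ← integral_smul]
        congr 1
        refine integral_congr_ae ?_
        filter_upwards [Lp.coeFn_smul c h] with x hx
        simp only [hx, Pi.smul_apply, Complex.real_smul, map_mul, Complex.conj_ofReal]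
        ring }
  refine ⟨ℓ.mkContinuous (‖u‖ ^ α) fun h => ?_, fun h => rfl, ?_⟩
  · refine (Complex.abs_re_le_norm _).trans ((norm_integral_le_integral_norm _).trans ?_)
    simp_rw [norm_rpow_smul_mul_conj hα]
    simpa using (Lp.integral_norm_rpow_mul_norm_rpow_le (by linarith) one_pos rfl u h).2
  have hint : ∀ v : Lp ℂ (ENNReal.ofReal (α + 1)) μ, Integrable (fun x => ‖v x‖ ^ (α + 1)) μ := by
    intro v
    have := (Lp.memLp v).integrable_norm_rpow (by simpa using hp) ENNReal.ofReal_ne_top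
    rwa [ENNReal.toReal_ofReal hp.le] at this
  have hrem : ∀ v : Lp ℂ (ENNReal.ofReal (α + 1)) μ,
      |(1 / (α + 1)) * ∫ x, ‖v x‖ ^ (α + 1) ∂μ - (1 / (α + 1)) * ∫ x, ‖u x‖ ^ (α + 1) ∂μ
          - (∫ x, ((‖u x‖ ^ (α - 1) : ℝ) • u x) * (starRingEnd ℂ) ((v - u : Lp ℂ _ μ) x) ∂μ).re|
        ≤ (α + 1) * (‖u‖ ^ (α - 1) * ‖v - u‖ ^ (2 : ℝ) + ‖v‖ ^ (α - 1) * ‖v - u‖ ^ (2 : ℝ)) := by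
    intro v
    have hI := Lp.integrable_rpow_smul_mul_conj hα u (v - u)
    have hu := Lp.integral_norm_rpow_mul_norm_rpow_le (a := α - 1) (b := 2) (by linarith)
      two_pos (by ring) u (v - u)
    have hv := Lp.integral_norm_rpow_mul_norm_rpow_le (a := α - 1) (b := 2) (by linarith)
      two_pos (by ring) v (v - u)
    have hre : (∫ x, ((‖u x‖ ^ (α - 1) : ℝ) • u x) * (starRingEnd ℂ) ((v - u : Lp ℂ _ μ) x) ∂μ).re
        = ∫ x, (((‖u x‖ ^ (α - 1) : ℝ) • u x) * (starRingEnd ℂ) ((v - u : Lp ℂ _ μ) x)).re ∂μ :=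
      (integral_re hI).symm
    have hd : Integrable (fun x => (1 / (α + 1)) * (‖v x‖ ^ (α + 1) - ‖u x‖ ^ (α + 1))) μ :=
      ((hint v).sub (hint u)).const_mul _
    have hI' : Integrable (fun x =>
        (((‖u x‖ ^ (α - 1) : ℝ) • u x) * (starRingEnd ℂ) ((v - u : Lp ℂ _ μ) x)).re) μ := hI.re
    rw [hre, ← mul_sub, ← integral_sub (hint v) (hint u), ← integral_const_mul,
      ← integral_sub hd hI']
    rw [← Real.norm_eq_abs]
    refine (norm_integral_le_of_norm_le ((hu.1.add hv.1).const_mul (α + 1)) ?_).trans ?_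
    · filter_upwards [Lp.coeFn_sub v u] with x hx
      have := abs_norm_rpow_taylor_remainder_le hα (u x) (v x)
      rw [hx, Pi.sub_apply, one_div_mul_eq_div]
      simpa only [Pi.add_apply, hx, Pi.sub_apply, Real.norm_eq_abs] using this
    · rw [integral_const_mul, integral_add' hu.1 hv.1]
      gcongr
      exacts [hu.2, hv.2]
  rw [hasFDerivAt_iff_tendsto]
  have hlim : Filter.Tendsto (fun v : Lp ℂ (ENNReal.ofReal (α + 1)) μ =>
      (α + 1) * (‖u‖ ^ (α - 1) + ‖v‖ ^ (α - 1)) * ‖v - u‖) (nhds u) (nhds 0) := by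
    have hc : Continuous (fun v : Lp ℂ (ENNReal.ofReal (α + 1)) μ =>
        (α + 1) * (‖u‖ ^ (α - 1) + ‖v‖ ^ (α - 1)) * ‖v - u‖) := by
      have := continuous_norm (E := Lp ℂ (ENNReal.ofReal (α + 1)) μ).rpow_const
        (p := α - 1) fun _ => Or.inr (by linarith)
      fun_prop
    simpa using hc.tendsto u
  refine squeeze_zero (fun v => by positivity) (fun v => ?_) hlim
  rcases eq_or_ne v u with rfl | hvu
  · simp
  · have hpos : 0 < ‖v - u‖ := norm_pos_iff.2 (sub_ne_zero.2 hvu)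
    rw [inv_mul_le_iff₀ hpos]
    refine (hrem v).trans (le_of_eq ?_)
    rw [Real.rpow_two]
    ring
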